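/- arXiv:2005.06690 — 2 statements merged into one kernel-verified Lean document; each statement's English description precedes it below -/
import Mathlib

section
/- Let k be a field, 𝒜 a k-linear Hom-finite, Ext-finite and Krull–Schmidt abelian category, and K an object with no nonzero injective direct summand. Then the following are equivalent: (1) every indecomposable direct summand of K is the first term of an almost split short exact sequence; (2) there exists a right minimal epimorphism α: X → Y which is right C-determined for some object C and whose kernel is isomorphic to K. -/
/- Preliminary definitions: the abelian-category instance of the extriangulated
notions of the paper (s-projective/injective morphisms and objects, almost split
short exact sequences, morphisms determined by objects, etc.). -/

open CategoryTheory CategoryTheory.Limits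

attribute [local instance] CategoryTheory.Abelian.hasFiniteBiproducts

universe w v u

variable {𝒜 : Type u} [Category.{v} 𝒜] [Abelian 𝒜]

section ExtDefs

variable [HasExt.{w} 𝒜]

/-- `f : X ⟶ Y` is a projective morphism if `Ext¹(f, A) : Ext¹(Y, A) → Ext¹(X, A)`
is zero for every object `A`. -/
def IsProjMorphism {X Y : 𝒜} (f : X ⟶ Y) : Prop :=
  ∀ (A : 𝒜) (δ : Abelian.Ext Y A 1), (Abelian.Ext.mk₀ f).comp δ (zero_add 1) = 0

/-- `f : X ⟶ Y` is an injective morphism if `Ext¹(A, f) : Ext¹(A, X) → Ext¹(A, Y)`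
is zero for every object `A`. -/
def IsInjMorphism {X Y : 𝒜} (f : X ⟶ Y) : Prop :=
  ∀ (A : 𝒜) (δ : Abelian.Ext A X 1), δ.comp (Abelian.Ext.mk₀ f) (add_zero 1) = 0

/-- An object `P` is (s-)projective when `Ext¹(P, A) = 0` for all `A`. -/
def IsExtProjective (P : 𝒜) : Prop := ∀ (A : 𝒜) (δ : Abelian.Ext P A 1), δ = 0

/-- An object `I` is (s-)injective when `Ext¹(A, I) = 0` for all `A`. -/
def IsExtInjective (I : 𝒜) : Prop := ∀ (A : 𝒜) (δ : Abelian.Ext A I 1), δ = 0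

/-- A short exact sequence `0 → X₁ → X₂ → X₃ → 0` with extension class `η` is
almost split if `η ≠ 0`, the pushout `a_*η` vanishes for every non-section
`a : X₁ ⟶ X'`, and the pullback `c^*η` vanishes for every non-retraction `c : Y' ⟶ X₃`. -/
def IsAlmostSplitSeq {S : ShortComplex 𝒜} (hS : S.ShortExact) : Prop :=
  hS.extClass ≠ 0 ∧
    (∀ (X' : 𝒜) (a : S.X₁ ⟶ X'), ¬ IsSplitMono a →
      hS.extClass.comp (Abelian.Ext.mk₀ a) (add_zero 1) = 0) ∧
    (∀ (Y' : 𝒜) (c : Y' ⟶ S.X₃), ¬ IsSplitEpi c →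
      (Abelian.Ext.mk₀ c).comp hS.extClass (zero_add 1) = 0)

/-- There exists an almost split short exact sequence `0 → A → E → B → 0`. -/
def ExistsAlmostSplitSeq (A B : 𝒜) : Prop :=
  ∃ (E : 𝒜) (i : A ⟶ E) (p : E ⟶ B) (w : i ≫ p = 0)
    (hS : (ShortComplex.mk i p w).ShortExact), IsAlmostSplitSeq hS

/-- There exists an almost split short exact sequence ending at `Y`. -/
def ExistsAlmostSplitEndingAt (Y : 𝒜) : Prop := ∃ X : 𝒜, ExistsAlmostSplitSeq X Y

/-- There exists an almost split short exact sequence starting at `X`. -/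
def ExistsAlmostSplitStartingAt (X : 𝒜) : Prop := ∃ Y : 𝒜, ExistsAlmostSplitSeq X Y

end ExtDefs

/-- `g` factors through `f` (both with target `Y`). -/
def FactorsThru {T X Y : 𝒜} (g : T ⟶ Y) (f : X ⟶ Y) : Prop := ∃ t : T ⟶ X, t ≫ f = g

/-- `f : X ⟶ Y` is right `C`-determined. -/
def RightDetermined (C : 𝒜) {X Y : 𝒜} (f : X ⟶ Y) : Prop :=
  ∀ (T : 𝒜) (g : T ⟶ Y), (∀ h : C ⟶ T, FactorsThru (h ≫ g) f) → FactorsThru g f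

/-- `Y` is a direct summand of `X`. -/
def IsDirectSummand (Y X : 𝒜) : Prop := ∃ (i : Y ⟶ X) (r : X ⟶ Y), i ≫ r = 𝟙 Y

/-- `X` is indecomposable: it is nonzero and in any biproduct decomposition one
of the factors vanishes. -/
def Indec (X : 𝒜) : Prop :=
  ¬ IsZero X ∧ ∀ (A B : 𝒜), Nonempty (X ≅ A ⊞ B) → IsZero A ∨ IsZero B

/-- `h : T ⟶ Z` lies in the radical: for every `u : Z ⟶ T` the composite
`h ∘ u` lies in the Jacobson radical of `End Z`. -/
def InRadical {T Z : 𝒜} (h : T ⟶ Z) : Prop :=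
  ∀ u : Z ⟶ T, (u ≫ h : End Z) ∈ (⊥ : Ideal (End Z)).jacobson

/-- `g : Z ⟶ Y` almost factors through `f : X ⟶ Y`. -/
def AlmostFactorsThru {Z X Y : 𝒜} (g : Z ⟶ Y) (f : X ⟶ Y) : Prop :=
  ¬ FactorsThru g f ∧ ∀ (T : 𝒜) (h : T ⟶ Z), InRadical h → FactorsThru (h ≫ g) f

/-- `y : B ⟶ C` is right almost split. -/
def RightAlmostSplit {B C : 𝒜} (y : B ⟶ C) : Prop :=
  ¬ IsSplitEpi y ∧ ∀ (B' : 𝒜) (h : B' ⟶ C), ¬ IsSplitEpi h → FactorsThru h y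

/-- `f : X ⟶ Y` is right minimal. -/
def RightMinimal {X Y : 𝒜} (f : X ⟶ Y) : Prop := ∀ g : X ⟶ X, g ≫ f = f → IsIso g

/-- A Krull–Schmidt category: every object is a finite biproduct of objects with
local endomorphism rings. -/
def IsKrullSchmidtCat (𝒞 : Type u) [Category.{v} 𝒞] [Abelian 𝒞] : Prop :=
  ∀ X : 𝒞, ∃ (n : ℕ) (Z : Fin n → 𝒞), Nonempty (X ≅ ⨁ Z) ∧ ∀ i, IsLocalRing (End (Z i))

section LinearStructure

variable {k : Type*} [Field k] [CategoryTheory.Linear k 𝒜] [HasExt.{w} 𝒜]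

lemma Ext_mk₀_add {X Y : 𝒜} (f g : X ⟶ Y) :
    Abelian.Ext.mk₀ (f + g) = Abelian.Ext.mk₀ f + Abelian.Ext.mk₀ g := by
  letI := HasDerivedCategory.standard 𝒜
  ext
  simp [ShiftedHom.mk₀, Abelian.Ext.add_hom]

/-- The `k`-module structure on the `Ext`-groups of a `k`-linear abelian category,
given by the composition with `r • 𝟙 X`. -/
noncomputable instance extModule (X Y : 𝒜) (n : ℕ) : Module k (Abelian.Ext X Y n) where
  smul r e := (Abelian.Ext.mk₀ (r • 𝟙 X)).comp e (zero_add n)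
  one_smul e := by
    show (Abelian.Ext.mk₀ ((1 : k) • 𝟙 X)).comp e (zero_add n) = e
    rw [one_smul, Abelian.Ext.mk₀_id_comp]
  mul_smul r s e := by
    show (Abelian.Ext.mk₀ ((r * s) • 𝟙 X)).comp e (zero_add n) =
      (Abelian.Ext.mk₀ (r • 𝟙 X)).comp
        ((Abelian.Ext.mk₀ (s • 𝟙 X)).comp e (zero_add n)) (zero_add n)
    rw [Abelian.Ext.mk₀_comp_mk₀_assoc]
    congr 2
    rw [Linear.smul_comp, Linear.comp_smul, Category.comp_id, smul_smul]
  smul_zero r := by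
    show (Abelian.Ext.mk₀ (r • 𝟙 X)).comp (0 : Abelian.Ext X Y n) (zero_add n) = 0
    exact Abelian.Ext.comp_zero _ Y n n (zero_add n)
  smul_add r e₁ e₂ := by
    show (Abelian.Ext.mk₀ (r • 𝟙 X)).comp (e₁ + e₂) (zero_add n) = _
    rw [Abelian.Ext.comp_add]; rfl
  add_smul r s e := by
    show (Abelian.Ext.mk₀ ((r + s) • 𝟙 X)).comp e (zero_add n) = _
    rw [add_smul, Ext_mk₀_add, Abelian.Ext.add_comp]; rfl
  zero_smul e := by
    show (Abelian.Ext.mk₀ ((0 : k) • 𝟙 X)).comp e (zero_add n) = 0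
    rw [zero_smul, Abelian.Ext.mk₀_zero, Abelian.Ext.zero_comp]

end LinearStructure

section AlmostSplit

/-- Pullbacks of the extension class vanish exactly along the morphisms that lift. -/
lemma mk₀_comp_extClass_eq_zero_iff [HasExt.{w} 𝒜] {S : ShortComplex 𝒜} (hS : S.ShortExact)
    {T : 𝒜} (c : T ⟶ S.X₃) :
    (Abelian.Ext.mk₀ c).comp hS.extClass (zero_add 1) = 0 ↔ FactorsThru c S.g := by
  constructor
  · intro h
    obtain ⟨x, hx⟩ := Abelian.Ext.covariant_sequence_exact₃ T hS (Abelian.Ext.mk₀ c) (zero_add 1) h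
    obtain ⟨t, rfl⟩ := Abelian.Ext.addEquiv₀.symm.surjective x
    refine ⟨t, ?_⟩
    apply Abelian.Ext.addEquiv₀.symm.injective
    simpa using hx
  · rintro ⟨t, rfl⟩
    rw [← Abelian.Ext.mk₀_comp_mk₀_assoc, hS.comp_extClass, Abelian.Ext.comp_zero]

/-- Pushouts of the extension class vanish exactly along the morphisms that extend. -/
lemma extClass_comp_mk₀_eq_zero_iff [HasExt.{w} 𝒜] {S : ShortComplex 𝒜} (hS : S.ShortExact)
    {T : 𝒜} (a : S.X₁ ⟶ T) :
    hS.extClass.comp (Abelian.Ext.mk₀ a) (add_zero 1) = 0 ↔ ∃ b : S.X₂ ⟶ T, S.f ≫ b = a := by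
  constructor
  · intro h
    obtain ⟨x, hx⟩ :=
      Abelian.Ext.contravariant_sequence_exact₁ hS T (Abelian.Ext.mk₀ a) (add_zero 1) h
    obtain ⟨t, rfl⟩ := Abelian.Ext.addEquiv₀.symm.surjective x
    refine ⟨t, ?_⟩
    apply Abelian.Ext.addEquiv₀.symm.injective
    simpa using hx
  · rintro ⟨t, rfl⟩
    rw [← Abelian.Ext.mk₀_comp_mk₀, hS.extClass_comp_assoc]

lemma isSplitEpi_of_comp_eq_id {X Y : 𝒜} {f : X ⟶ Y} {s : Y ⟶ X} (h : s ≫ f = 𝟙 Y) :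
    IsSplitEpi f := ⟨⟨⟨s, h⟩⟩⟩

lemma isSplitMono_of_comp_eq_id {X Y : 𝒜} {f : X ⟶ Y} {r : Y ⟶ X} (h : f ≫ r = 𝟙 X) :
    IsSplitMono f := ⟨⟨⟨r, h⟩⟩⟩

/-- In a short exact sequence, the first map splits if the second does. -/
lemma CategoryTheory.ShortComplex.ShortExact.exists_retraction {S : ShortComplex 𝒜}
    (hS : S.ShortExact) {s : S.X₃ ⟶ S.X₂} (h : s ≫ S.g = 𝟙 _) :
    ∃ r : S.X₂ ⟶ S.X₁, S.f ≫ r = 𝟙 _ := by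
  have := hS.mono_f
  obtain ⟨r, hr⟩ := hS.exact.lift' (𝟙 _ - S.g ≫ s) (by simp [h])
  refine ⟨r, ?_⟩
  rw [← cancel_mono S.f, Category.assoc, hr]
  simp

/-- In a short exact sequence, the second map splits if the first does. -/
lemma CategoryTheory.ShortComplex.ShortExact.exists_section {S : ShortComplex 𝒜}
    (hS : S.ShortExact) {r : S.X₂ ⟶ S.X₁} (h : S.f ≫ r = 𝟙 _) :
    ∃ s : S.X₃ ⟶ S.X₂, s ≫ S.g = 𝟙 _ := by
  have := hS.epi_g
  obtain ⟨s, hs⟩ := hS.exact.desc' (𝟙 _ - r ≫ S.f) (by simp [reassoc_of% h])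
  refine ⟨s, ?_⟩
  rw [← cancel_epi S.g, ← Category.assoc, hs]
  simp

lemma isAlmostSplitSeq_iff [HasExt.{w} 𝒜] {S : ShortComplex 𝒜} (hS : S.ShortExact) :
    IsAlmostSplitSeq hS ↔ ¬ IsSplitMono S.f ∧
      (∀ (X' : 𝒜) (a : S.X₁ ⟶ X'), ¬ IsSplitMono a → ∃ b : S.X₂ ⟶ X', S.f ≫ b = a) ∧
      (∀ (Y' : 𝒜) (c : Y' ⟶ S.X₃), ¬ IsSplitEpi c → FactorsThru c S.g) := by
  have key : hS.extClass = 0 ↔ IsSplitMono S.f := by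
    have := extClass_comp_mk₀_eq_zero_iff hS (𝟙 _)
    rw [Abelian.Ext.comp_mk₀_id] at this
    rw [this]
    exact ⟨fun ⟨r, hr⟩ => isSplitMono_of_comp_eq_id hr, fun h => ⟨retraction S.f, by simp⟩⟩
  simp only [IsAlmostSplitSeq, ne_eq, key, extClass_comp_mk₀_eq_zero_iff,
    mk₀_comp_extClass_eq_zero_iff]

end AlmostSplit

section LocalObjects

/-- An object with local endomorphism ring, expressed through isomorphisms. -/
def IsLocalObject (Z : 𝒜) : Prop :=
  ¬ IsZero Z ∧ ∀ φ : Z ⟶ Z, IsIso φ ∨ IsIso (𝟙 Z - φ)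

lemma isLocalObject_of_isLocalRing {Z : 𝒜} (h : IsLocalRing (End Z)) : IsLocalObject Z := by
  refine ⟨fun hz => one_ne_zero (α := End Z) (hz.eq_of_src _ _), fun φ => ?_⟩
  have := h.isUnit_or_isUnit_of_add_one (a := (φ : End Z)) (b := (𝟙 Z - φ : Z ⟶ Z))
    (by change φ + (𝟙 Z - φ) = 𝟙 Z; abel)
  rwa [isUnit_iff_isIso, isUnit_iff_isIso] at this

lemma IsLocalObject.of_iso {Z Z' : 𝒜} (h : IsLocalObject Z) (e : Z ≅ Z') : IsLocalObject Z' := by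
  refine ⟨fun hz => h.1 (hz.of_iso e), fun φ => ?_⟩
  rcases h.2 (e.hom ≫ φ ≫ e.inv) with h' | h'
  · left
    have : φ = e.inv ≫ (e.hom ≫ φ ≫ e.inv) ≫ e.hom := by simp
    rw [this]; infer_instance
  · right
    have : 𝟙 Z' - φ = e.inv ≫ (𝟙 Z - e.hom ≫ φ ≫ e.inv) ≫ e.hom := by simp
    rw [this]; infer_instance

lemma IsLocalObject.isIso_or_isIso {Z : 𝒜} (h : IsLocalObject Z) {φ ψ : Z ⟶ Z}
    (hs : IsIso (φ + ψ)) : IsIso φ ∨ IsIso ψ := by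
  have hψ : 𝟙 Z - φ ≫ inv (φ + ψ) = ψ ≫ inv (φ + ψ) := by
    rw [sub_eq_iff_eq_add', ← Preadditive.add_comp, IsIso.hom_inv_id]
  rcases h.2 (φ ≫ inv (φ + ψ)) with h' | h'
  · left
    exact IsIso.of_isIso_comp_right φ (inv (φ + ψ))
  · right
    rw [hψ] at h'
    exact IsIso.of_isIso_comp_right ψ (inv (φ + ψ))

lemma IsLocalObject.exists_isIso_of_sum {Z : 𝒜} (h : IsLocalObject Z) {J : Type*} (s : Finset J)
    (φ : J → (Z ⟶ Z)) (hs : IsIso (∑ j ∈ s, φ j)) : ∃ j ∈ s, IsIso (φ j) := by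
  classical
  induction s using Finset.induction_on with
  | empty =>
    rw [Finset.sum_empty] at hs
    refine absurd ?_ h.1
    rw [IsZero.iff_id_eq_zero, ← IsIso.hom_inv_id (0 : Z ⟶ Z), zero_comp]
  | insert j s hj ih =>
    rw [Finset.sum_insert hj] at hs
    rcases h.isIso_or_isIso hs with h₁ | h₁
    · exact ⟨j, Finset.mem_insert_self _ _, h₁⟩
    · obtain ⟨l, hl, hl'⟩ := ih h₁
      exact ⟨l, Finset.mem_insert_of_mem hl, hl'⟩

/-- A retract of a local object which is nonzero is the whole object. -/
lemma IsLocalObject.isIso_of_retract {Z W : 𝒜} (hZ : IsLocalObject Z) (hW : ¬ IsZero W)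
    {a : W ⟶ Z} {b : Z ⟶ W} (hab : a ≫ b = 𝟙 W) : IsIso b := by
  rcases hZ.2 (b ≫ a) with h | h
  · have : IsSplitEpi b := isSplitEpi_of_comp_eq_id hab
    have : Mono b := mono_of_mono b a
    exact isIso_of_mono_of_isSplitEpi b
  · refine absurd ?_ hW
    have h0 : (𝟙 Z - b ≫ a) ≫ b = 0 := by simp [hab]
    have hb : b = 0 := by rwa [← cancel_epi (𝟙 Z - b ≫ a), comp_zero]
    rw [IsZero.iff_id_eq_zero, ← hab, hb, comp_zero]

/-- A retract gives a biproduct decomposition. -/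
lemma exists_iso_biprod_of_retract {Z W : 𝒜} {a : W ⟶ Z} {b : Z ⟶ W} (hab : a ≫ b = 𝟙 W) :
    Nonempty (Z ≅ W ⊞ kernel b) := by
  refine ⟨⟨biprod.lift b (kernel.lift b (𝟙 Z - b ≫ a) (by simp [hab])),
    biprod.desc a (kernel.ι b), ?_, ?_⟩⟩
  · simp [biprod.lift_desc]
  · apply biprod.hom_ext' <;> apply biprod.hom_ext
    · simp [hab]
    · rw [← cancel_mono (kernel.ι b)]
      simp [reassoc_of% hab]
    · simp
    · rw [← cancel_mono (kernel.ι b)]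
      simp

lemma IsLocalObject.indec {Z : 𝒜} (h : IsLocalObject Z) : Indec Z := by
  refine ⟨h.1, fun A B ⟨e⟩ => or_iff_not_imp_left.2 fun hA => ?_⟩
  have h1 := h.isIso_of_retract hA (a := biprod.inl ≫ e.inv) (b := e.hom ≫ biprod.fst) (by simp)
  have h2 : IsIso (biprod.fst : A ⊞ B ⟶ A) := IsIso.of_isIso_comp_left e.hom _
  rw [IsZero.iff_id_eq_zero, ← cancel_mono (biprod.inr : B ⟶ A ⊞ B), ← cancel_mono biprod.fst]
  simp

end LocalObjects

section KrullSchmidt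

/-- A nonzero object of a Krull-Schmidt category has a local direct summand. -/
lemma IsKrullSchmidtCat.exists_local_summand (hKS : IsKrullSchmidtCat 𝒜) {Z : 𝒜}
    (hZ : ¬ IsZero Z) :
    ∃ (W : 𝒜) (a : W ⟶ Z) (b : Z ⟶ W), a ≫ b = 𝟙 W ∧ IsLocalObject W := by
  obtain ⟨n, W, ⟨e⟩, hW⟩ := hKS Z
  rcases Nat.eq_zero_or_pos n with rfl | hn
  · refine absurd ?_ hZ
    refine IsZero.of_iso ?_ e
    rw [IsZero.iff_id_eq_zero]
    ext j
    exact j.elim0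
  · exact ⟨W ⟨0, hn⟩, biproduct.ι W _ ≫ e.inv, e.hom ≫ biproduct.π W _, by simp,
      isLocalObject_of_isLocalRing (hW _)⟩

lemma IsKrullSchmidtCat.isLocalObject_of_indec (hKS : IsKrullSchmidtCat 𝒜) {Z : 𝒜}
    (hZ : Indec Z) : IsLocalObject Z := by
  obtain ⟨W, a, b, hab, hW⟩ := hKS.exists_local_summand hZ.1
  rcases hZ.2 _ _ (exists_iso_biprod_of_retract hab) with h | h
  · exact absurd h hW.1
  · have : IsSplitEpi b := isSplitEpi_of_comp_eq_id hab
    have : Mono b := Preadditive.mono_of_kernel_zero (h.eq_of_src _ _)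
    have : IsIso b := isIso_of_mono_of_isSplitEpi b
    exact hW.of_iso (asIso b).symm

end KrullSchmidt

section RightMinimal

/-- The Fitting idempotent of an element of a commutative Artinian ring. -/
lemma exists_fitting_idempotent_comm {R : Type*} [CommRing R] [IsArtinianRing R] (x : R) :
    ∃ (e : R) (N : ℕ), e * e = e ∧ x ^ N * e = 0 ∧ (e = 0 → IsUnit x) := by
  obtain ⟨n, y, hy⟩ := IsArtinian.exists_pow_succ_smul_dvd x (1 : R)
  simp only [smul_eq_mul, mul_one, Nat.succ_eq_add_one] at hy
  have key : ∀ m, x ^ (n + 1 + m) * y ^ m = x ^ (n + 1) := by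
    intro m
    induction m with
    | zero => simp
    | succ m ih =>
      calc x ^ (n + 1 + (m + 1)) * y ^ (m + 1)
          = (x ^ (n + 1) * y) * x ^ (m + 1) * y ^ m := by ring
        _ = x ^ (n + 1 + m) * y ^ m := by rw [hy]; ring
        _ = _ := ih
  have hk := key (n + 1)
  have hz : x ^ (n + 1) * (1 - x ^ (n + 1) * y ^ (n + 1)) = 0 := by
    linear_combination -hk
  refine ⟨1 - x ^ (n + 1) * y ^ (n + 1), n + 1, ?_, hz, fun h => ?_⟩
  · linear_combination -y ^ (n + 1) * hz
  · exact IsUnit.of_mul_eq_one (x ^ n * y ^ (n + 1)) (by linear_combination -h)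

/-- The Fitting idempotent of an element of a finite-dimensional algebra. -/
lemma exists_fitting_idempotent (k : Type*) {A : Type*} [Field k] [Ring A] [Algebra k A]
    [FiniteDimensional k A] (x : A) :
    ∃ (e : A) (N : ℕ), e * e = e ∧ x ^ N * e = 0 ∧ (e = 0 → IsUnit x) := by
  have : IsMulCommutative (Algebra.adjoin k {x}) := Algebra.isMulCommutative_adjoin k (by
    rintro a rfl b rfl; rfl)
  have : IsArtinianRing (Algebra.adjoin k {x}) := IsArtinianRing.of_finite k _
  obtain ⟨e, N, h₁, h₂, h₃⟩ := exists_fitting_idempotent_comm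
    (⟨x, Algebra.self_mem_adjoin_singleton k x⟩ : Algebra.adjoin k {x})
  refine ⟨e, N, congrArg Subtype.val h₁, congrArg Subtype.val h₂, fun h => ?_⟩
  exact (h₃ (Subtype.ext h)).map (Algebra.adjoin k {x}).val

lemma RightMinimal.isZero_of_retract {X Y Z : 𝒜} {f : X ⟶ Y} (hf : RightMinimal f)
    {i : Z ⟶ X} {r : X ⟶ Z} (h : i ≫ r = 𝟙 Z) (hi : i ≫ f = 0) : IsZero Z := by
  have h1 : IsIso (𝟙 X - r ≫ i) := hf _ (by simp [hi])
  have h0 : i ≫ (𝟙 X - r ≫ i) = 0 := by simp [reassoc_of% h]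
  have : i = 0 := by rwa [← cancel_mono (𝟙 X - r ≫ i), zero_comp]
  rw [IsZero.iff_id_eq_zero, ← h, this, zero_comp]

/-- A morphism whose kernel contains no local summand of its source is right minimal. -/
lemma rightMinimal_of_local_retract (k : Type*) [Field k] [Linear k 𝒜]
    (homFin : ∀ A B : 𝒜, FiniteDimensional k (A ⟶ B)) (hKS : IsKrullSchmidtCat 𝒜)
    {X Y : 𝒜} (f : X ⟶ Y)
    (hf : ∀ (Z : 𝒜) (i : Z ⟶ X) (r : X ⟶ Z), IsLocalObject Z → i ≫ r = 𝟙 Z → i ≫ f ≠ 0) :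
    RightMinimal f := by
  intro g hg
  change End X at g
  by_contra hiso
  have : FiniteDimensional k (End X) := homFin X X
  obtain ⟨e, N, he, heN, hu⟩ := exists_fitting_idempotent k g
  have he0 : e ≠ 0 := fun h => hiso ((isUnit_iff_isIso _).1 (hu h))
  have hpow : ∀ m : ℕ, (g ^ m : End X) ≫ f = f := by
    intro m
    induction m with
    | zero => exact Category.id_comp f
    | succ m ih =>
      rw [pow_succ, End.mul_def, Category.assoc, ih, hg]
  have he' : (e : X ⟶ X) ≫ (e : X ⟶ X) = e := he
  have hcomm : (e : X ⟶ X) ≫ f = 0 := by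
    rw [← hpow N, ← Category.assoc]
    have : (e : X ⟶ X) ≫ (g ^ N : End X) = 0 := heN
    rw [this, zero_comp]
  have hfac := image.fac (e : X ⟶ X)
  have hid : image.ι (e : X ⟶ X) ≫ factorThruImage (e : X ⟶ X) = 𝟙 _ := by
    rw [← cancel_mono (image.ι (e : X ⟶ X)), ← cancel_epi (factorThruImage (e : X ⟶ X))]
    simp [he']
  have hZ : ¬ IsZero (image (e : X ⟶ X)) := by
    intro hz
    apply he0
    rw [← hfac, hz.eq_of_src (image.ι (e : X ⟶ X)) 0, comp_zero]
  obtain ⟨W, a, b, hab, hW⟩ := hKS.exists_local_summand hZ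
  refine hf W (a ≫ image.ι (e : X ⟶ X)) (factorThruImage (e : X ⟶ X) ≫ b) hW ?_ ?_
  · simp [reassoc_of% hid, hab]
  · have : image.ι (e : X ⟶ X) ≫ f = 0 := by
      rw [← cancel_epi (factorThruImage (e : X ⟶ X)), image.fac_assoc, hcomm, comp_zero]
    rw [Category.assoc, this, comp_zero]

end RightMinimal

section Constructions

/-- A monomorphism through which every morphism killed by the epimorphism `g` factors
is the first map of a short exact sequence. -/
lemma shortExact_of_lift {A B C : 𝒜} {f : A ⟶ B} {g : B ⟶ C} (w : f ≫ g = 0) [Mono f] [Epi g]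
    (h : ∀ (T : 𝒜) (x : T ⟶ B), x ≫ g = 0 → ∃ y : T ⟶ A, y ≫ f = x) :
    (ShortComplex.mk f g w).ShortExact where
  exact := ShortComplex.exact_of_f_is_kernel _
    (KernelFork.IsLimit.ofι' f w fun x hx => ⟨(h _ x hx).choose, (h _ x hx).choose_spec⟩)
  mono_f := ‹_›
  epi_g := ‹_›

lemma shortExact_of_desc {A B C : 𝒜} {f : A ⟶ B} {g : B ⟶ C} (w : f ≫ g = 0) [Mono f] [Epi g]
    (h : ∀ (T : 𝒜) (x : B ⟶ T), f ≫ x = 0 → ∃ y : C ⟶ T, g ≫ y = x) :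
    (ShortComplex.mk f g w).ShortExact where
  exact := ShortComplex.exact_of_g_is_cokernel _
    (CokernelCofork.IsColimit.ofπ' g w fun x hx => ⟨(h _ x hx).choose, (h _ x hx).choose_spec⟩)
  mono_f := ‹_›
  epi_g := ‹_›

/-- The pullback of a short exact sequence. -/
lemma exists_pullback_shortExact {S : ShortComplex 𝒜} (hS : S.ShortExact) {W : 𝒜}
    (w : W ⟶ S.X₃) :
    ∃ (E : 𝒜) (f : S.X₁ ⟶ E) (p : E ⟶ W) (zero : f ≫ p = 0),
      (ShortComplex.mk f p zero).ShortExact ∧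
      ∀ (T : 𝒜) (c : T ⟶ W), FactorsThru c p ↔ FactorsThru (c ≫ w) S.g := by
  have := hS.mono_f
  have := hS.epi_g
  let f : S.X₁ ⟶ pullback S.g w := pullback.lift S.f 0 (by simp)
  have hf : f ≫ pullback.fst S.g w = S.f := pullback.lift_fst _ _ _
  have hf' : f ≫ pullback.snd S.g w = 0 := pullback.lift_snd _ _ _
  have hmono : Mono f := mono_of_mono_fac hf
  refine ⟨pullback S.g w, f, pullback.snd S.g w, hf', shortExact_of_lift hf' ?_, ?_⟩
  · intro T x hx
    obtain ⟨y, hy⟩ := hS.exact.lift' (x ≫ pullback.fst S.g w) (by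
      rw [Category.assoc, pullback.condition, reassoc_of% hx, zero_comp])
    refine ⟨y, pullback.hom_ext ?_ ?_⟩
    · rw [Category.assoc, hf, hy]
    · rw [Category.assoc, hf', comp_zero, hx]
  · intro T c
    constructor
    · rintro ⟨t, rfl⟩
      exact ⟨t ≫ pullback.fst S.g w, by rw [Category.assoc, Category.assoc, pullback.condition]⟩
    · rintro ⟨t, ht⟩
      exact ⟨pullback.lift t c ht, pullback.lift_snd _ _ _⟩

/-- The pushout of a short exact sequence. -/
lemma exists_pushout_shortExact {S : ShortComplex 𝒜} (hS : S.ShortExact) {Z' : 𝒜}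
    (a : S.X₁ ⟶ Z') :
    ∃ (E : 𝒜) (f : Z' ⟶ E) (p : E ⟶ S.X₃) (b : S.X₂ ⟶ E) (zero : f ≫ p = 0),
      (ShortComplex.mk f p zero).ShortExact ∧ S.f ≫ b = a ≫ f ∧ b ≫ p = S.g := by
  have := hS.mono_f
  have := hS.epi_g
  let p : pushout S.f a ⟶ S.X₃ := pushout.desc S.g 0 (by simp)
  have hp : pushout.inl S.f a ≫ p = S.g := pushout.inl_desc _ _ _
  have hp' : pushout.inr S.f a ≫ p = 0 := pushout.inr_desc _ _ _
  have hepi : Epi p := epi_of_epi_fac hp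
  refine ⟨pushout S.f a, pushout.inr S.f a, p, pushout.inl S.f a, hp',
    shortExact_of_desc hp' ?_, pushout.condition, hp⟩
  intro T x hx
  obtain ⟨y, hy⟩ := hS.exact.desc' (pushout.inl S.f a ≫ x) (by
    rw [pushout.condition_assoc, hx, comp_zero])
  refine ⟨y, pushout.hom_ext ?_ ?_⟩
  · rw [reassoc_of% hp, hy]
  · rw [reassoc_of% hp', zero_comp, hx]

end Constructions

section Forward

/-- The biproduct of short exact sequences. -/
lemma shortExact_biproduct {n : ℕ} {A B C : Fin n → 𝒜} (f : ∀ j, A j ⟶ B j) (g : ∀ j, B j ⟶ C j)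
    (w : ∀ j, f j ≫ g j = 0) (h : ∀ j, (ShortComplex.mk (f j) (g j) (w j)).ShortExact)
    (w' : biproduct.map f ≫ biproduct.map g = 0) :
    (ShortComplex.mk (biproduct.map f) (biproduct.map g) w').ShortExact := by
  have hf : ∀ j, Mono (f j) := fun j => (h j).mono_f
  have hg : ∀ j, Epi (g j) := fun j => (h j).epi_g
  refine shortExact_of_lift w' fun T x hx => ?_
  have hx' : ∀ j, (x ≫ biproduct.π B j) ≫ g j = 0 := fun j => by
    rw [Category.assoc, ← biproduct.map_π, reassoc_of% hx, zero_comp]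
  choose y hy using fun j => (h j).exact.lift' (x ≫ biproduct.π B j) (hx' j)
  dsimp only at y hy
  refine ⟨biproduct.lift y, ?_⟩
  ext j
  simp [hy]

/-- A biproduct of right almost split morphisms is right determined by the biproduct of their
targets. -/
lemma rightDetermined_biproduct_map {n : ℕ} {B C : Fin n → 𝒜} (g : ∀ j, B j ⟶ C j)
    (hg : ∀ j, RightAlmostSplit (g j)) : RightDetermined (⨁ C) (biproduct.map g) := by
  intro T x hx
  have key : ∀ j, FactorsThru (x ≫ biproduct.π C j) (g j) := by
    intro j
    refine (hg j).2 _ _ fun hsplit => (hg j).1 ?_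
    obtain ⟨t, ht⟩ := hx (biproduct.π C j ≫ section_ (x ≫ biproduct.π C j))
    refine isSplitEpi_of_comp_eq_id (s := biproduct.ι C j ≫ t ≫ biproduct.π B j) ?_
    rw [Category.assoc, Category.assoc, ← biproduct.map_π, reassoc_of% ht]
    simp
  choose t ht using key
  refine ⟨biproduct.lift t, ?_⟩
  ext j
  simp [ht]

/-- If `Z` is a local object which is a retract of a biproduct of local objects, then some
component of the retraction is a split monomorphism. -/
lemma IsLocalObject.exists_isSplitMono_of_retract {Z : 𝒜} (hZ : IsLocalObject Z) {n : ℕ}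
    {A : Fin n → 𝒜} (hA : ∀ j, IsLocalObject (A j)) {i : Z ⟶ ⨁ A} {r : ⨁ A ⟶ Z}
    (hir : i ≫ r = 𝟙 Z) : ∃ j, IsSplitMono (biproduct.ι A j ≫ r) := by
  have hsum : ∑ j, (i ≫ biproduct.π A j) ≫ (biproduct.ι A j ≫ r) = 𝟙 Z := by
    rw [← hir]
    conv_rhs => rw [← Category.id_comp r, ← biproduct.total, Preadditive.sum_comp,
      Preadditive.comp_sum]
    simp only [Category.assoc]
  obtain ⟨j, -, hj⟩ := hZ.exists_isIso_of_sum Finset.univ _ (by rw [hsum]; infer_instance)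
  have := (hA j).isIso_of_retract hZ.1
    (a := inv ((i ≫ biproduct.π A j) ≫ (biproduct.ι A j ≫ r)) ≫ i ≫ biproduct.π A j)
    (b := biproduct.ι A j ≫ r) (by
      rw [← IsIso.inv_hom_id ((i ≫ biproduct.π A j) ≫ (biproduct.ι A j ≫ r))]
      simp only [Category.assoc])
  exact ⟨j, inferInstance⟩

/-- An object whose indecomposable summands start almost split sequences is the kernel of a right
minimal, right determined epimorphism. -/
lemma exists_rightMinimal_rightDetermined [HasExt.{w} 𝒜] (k : Type*) [Field k] [Linear k 𝒜]
    (homFin : ∀ A B : 𝒜, FiniteDimensional k (A ⟶ B)) (hKS : IsKrullSchmidtCat 𝒜) {K : 𝒜}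
    (hK : ∀ Z : 𝒜, IsDirectSummand Z K → Indec Z → ExistsAlmostSplitStartingAt Z) :
    ∃ (X Y : 𝒜) (ι : K ⟶ X) (α : X ⟶ Y) (w : ι ≫ α = 0)
      (_ : (ShortComplex.mk ι α w).ShortExact),
      RightMinimal α ∧ ∃ C : 𝒜, RightDetermined C α := by
  obtain ⟨n, A, ⟨e⟩, hA'⟩ := hKS K
  have hA : ∀ j, IsLocalObject (A j) := fun j => isLocalObject_of_isLocalRing (hA' j)
  have key : ∀ j, ExistsAlmostSplitStartingAt (A j) := fun j =>
    hK _ ⟨biproduct.ι A j ≫ e.inv, e.hom ≫ biproduct.π A j, by simp⟩ (hA j).indec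
  choose C B f g w hS hAS using key
  have hAS' := fun j => (isAlmostSplitSeq_iff (hS j)).1 (hAS j)
  have w' : biproduct.map f ≫ biproduct.map g = 0 := by ext; simp [w]
  have hS' := shortExact_biproduct f g w hS w'
  have := hS'.mono_f
  have := hS'.epi_g
  have hmono : Mono (e.hom ≫ biproduct.map f) := mono_comp _ _
  refine ⟨⨁ B, ⨁ C, e.hom ≫ biproduct.map f, biproduct.map g, by simp [w'], ?_, ?_, ⨁ C, ?_⟩
  · refine shortExact_of_lift _ fun T x hx => ?_
    obtain ⟨y, hy⟩ := hS'.exact.lift' x hx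
    exact ⟨y ≫ e.inv, by simpa using hy⟩
  · refine rightMinimal_of_local_retract k homFin hKS _ fun Z i r hZ hir hi => ?_
    obtain ⟨y, hy⟩ := hS'.exact.lift' i hi
    dsimp only at y hy
    obtain ⟨j, hj⟩ := hZ.exists_isSplitMono_of_retract hA (i := y) (r := biproduct.map f ≫ r)
      (by rw [reassoc_of% hy, hir])
    rw [← Category.assoc, biproduct.ι_map, Category.assoc] at hj
    refine (hAS' j).1 (isSplitMono_of_comp_eq_id
      (r := (biproduct.ι B j ≫ r) ≫ retraction (f j ≫ biproduct.ι B j ≫ r)) ?_)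
    exact (Category.assoc _ _ _).symm.trans (IsSplitMono.id (f j ≫ biproduct.ι B j ≫ r))
  · refine rightDetermined_biproduct_map g fun j => ⟨fun hsplit => (hAS' j).1 ?_, (hAS' j).2.2⟩
    obtain ⟨r, hr⟩ := (hS j).exists_retraction (s := section_ (g j)) (by simp)
    exact isSplitMono_of_comp_eq_id hr

end Forward

section Backward

/-- If `K ⟶ X ⟶ Y` is short exact with a right `C`-determined epimorphism and `Z` is a direct
summand of `K`, then the cokernel of `Z ⟶ X` is right `C`-determined. -/
lemma rightDetermined_of_summand {K X Y Z Y' C : 𝒜} {ι : K ⟶ X} {α : X ⟶ Y} {w : ι ≫ α = 0}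
    (hS : (ShortComplex.mk ι α w).ShortExact) (hα : RightDetermined C α)
    {i : Z ⟶ K} {r : K ⟶ Z} (hir : i ≫ r = 𝟙 Z) {q : X ⟶ Y'} {w' : (i ≫ ι) ≫ q = 0}
    (hS' : (ShortComplex.mk (i ≫ ι) q w').ShortExact) : RightDetermined C q := by
  have : Mono ι := hS.mono_f
  have : Epi q := hS'.epi_g
  have : Mono (i ≫ ι) := hS'.mono_f
  obtain ⟨π, hπ⟩ := hS'.exact.desc' α (by simp [w])
  dsimp only at π hπ
  have lifts : ∀ (T : 𝒜) (x : T ⟶ Y'), x ≫ π = 0 → FactorsThru x q := by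
    intro T x hx
    obtain ⟨z, hz⟩ := hS.exact.lift' (pullback.snd x q) (by
      change pullback.snd x q ≫ α = 0
      rw [← hπ, ← pullback.condition_assoc, hx, comp_zero])
    dsimp only at z hz
    have hk : kernel.ι (pullback.fst x q) ≫ z ≫ (𝟙 K - r ≫ i) = 0 := by
      obtain ⟨m, hm⟩ := hS'.exact.lift' (kernel.ι (pullback.fst x q) ≫ pullback.snd x q) (by
        change (kernel.ι (pullback.fst x q) ≫ pullback.snd x q) ≫ q = 0
        rw [Category.assoc, ← pullback.condition, kernel.condition_assoc, zero_comp])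
      dsimp only at m hm
      have : kernel.ι (pullback.fst x q) ≫ z = m ≫ i := by
        rw [← cancel_mono ι, Category.assoc, hz, Category.assoc, hm]
      rw [reassoc_of% this]
      simp [reassoc_of% hir]
    let d := Abelian.epiDesc (pullback.fst x q) (z ≫ (𝟙 K - r ≫ i)) hk
    have hd : pullback.fst x q ≫ d = z ≫ (𝟙 K - r ≫ i) := Abelian.comp_epiDesc _ _ _
    refine ⟨d ≫ ι, ?_⟩
    have w'' : i ≫ ι ≫ q = 0 := by simpa using w'
    rw [← cancel_epi (pullback.fst x q), Category.assoc, reassoc_of% hd, pullback.condition, ← hz]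
    simp [w'']
  intro T g hg
  obtain ⟨t, ht⟩ := hα T (g ≫ π) fun h => by
    obtain ⟨s, hs⟩ := hg h
    exact ⟨s, by rw [← hπ, ← Category.assoc, hs, Category.assoc]⟩
  obtain ⟨u, hu⟩ := lifts T (g - t ≫ q) (by simp [hπ, ht])
  exact ⟨t + u, by simp [hu]⟩

/-- For a right `C`-determined morphism `q` which is not a split epimorphism, some morphism that does
not factor through `q` does so after precomposition with any morphism which is not a split epi. -/
lemma exists_minimal_not_factorsThru (k : Type*) [Field k] [Linear k 𝒜]
    (homFin : ∀ A B : 𝒜, FiniteDimensional k (A ⟶ B)) (hKS : IsKrullSchmidtCat 𝒜)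
    {C X Y : 𝒜} {q : X ⟶ Y} (hq : RightDetermined C q) (hs : ¬ IsSplitEpi q) :
    ∃ (W : 𝒜) (w : W ⟶ Y), ¬ FactorsThru w q ∧
      ∀ (T : 𝒜) (c : T ⟶ W), ¬ IsSplitEpi c → FactorsThru (c ≫ w) q := by
  have hex : ∃ w : C ⟶ Y, ¬ FactorsThru w q := by
    by_contra! h
    obtain ⟨t, ht⟩ := hq Y (𝟙 Y) fun h' => by simpa using h h'
    exact hs (isSplitEpi_of_comp_eq_id ht)
  let N : (C ⟶ Y) → Submodule k (C ⟶ Y) := fun w =>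
    LinearMap.range (Linear.rightComp k C w) ⊔ LinearMap.range (Linear.rightComp k C q)
  have hN : ∀ w x : C ⟶ Y, x ∈ N w ↔ ∃ (u : C ⟶ C) (t : C ⟶ X), u ≫ w + t ≫ q = x := by
    intro w x
    simp [N, Submodule.mem_sup]
  have := homFin C Y
  obtain ⟨w, hw, hmin⟩ := (InvImage.wf N (wellFounded_lt (α := Submodule k (C ⟶ Y)))).has_min
    {w | ¬ FactorsThru w q} hex
  have hret : ∀ u : C ⟶ C, ¬ FactorsThru (u ≫ w) q →
      ∃ v : C ⟶ C, FactorsThru (w - v ≫ u ≫ w) q := by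
    intro u hu
    have hle : N (u ≫ w) ≤ N w := by
      intro x hx
      obtain ⟨v, t, rfl⟩ := (hN _ _).1 hx
      exact (hN _ _).2 ⟨v ≫ u, t, by simp⟩
    have heq : N (u ≫ w) = N w := by
      by_contra hne
      exact hmin _ hu (lt_of_le_of_ne hle hne)
    obtain ⟨v, t, hvt⟩ := (hN (u ≫ w) w).1 (by
      rw [heq]
      exact (hN _ _).2 ⟨𝟙 C, 0, by simp⟩)
    exact ⟨v, t, by rw [eq_sub_iff_add_eq', hvt]⟩
  obtain ⟨n, A, ⟨e⟩, hA⟩ := hKS C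
  have hj : ∃ j, ¬ FactorsThru ((biproduct.ι A j ≫ e.inv) ≫ w) q := by
    by_contra! h
    choose t ht using h
    refine hw ⟨e.hom ≫ biproduct.desc t, ?_⟩
    rw [Category.assoc, ← Iso.eq_inv_comp]
    ext j
    simpa using ht j
  obtain ⟨j, hj⟩ := hj
  refine ⟨A j, (biproduct.ι A j ≫ e.inv) ≫ w, hj, fun T c hc => ?_⟩
  refine hq _ _ fun h => ?_
  by_contra hf
  obtain ⟨v, t, ht⟩ := hret (h ≫ c ≫ biproduct.ι A j ≫ e.inv) (by simpa using hf)
  let φ : A j ⟶ A j := (biproduct.ι A j ≫ e.inv) ≫ v ≫ h ≫ c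
  have hφ : (𝟙 _ - φ) ≫ (biproduct.ι A j ≫ e.inv) ≫ w = ((biproduct.ι A j ≫ e.inv) ≫ t) ≫ q := by
    rw [Category.assoc _ t, ht]
    simp [φ]
  rcases (isLocalObject_of_isLocalRing (hA j)).2 φ with hiso | hiso
  · refine hc (isSplitEpi_of_comp_eq_id
      (s := inv φ ≫ (biproduct.ι A j ≫ e.inv) ≫ v ≫ h) ?_)
    rw [← IsIso.inv_hom_id φ]
    simp only [φ, Category.assoc]
  · refine hj ⟨inv (𝟙 _ - φ) ≫ (biproduct.ι A j ≫ e.inv) ≫ t, ?_⟩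
    rw [Category.assoc, ← hφ, IsIso.inv_hom_id_assoc]

/-- A short exact sequence whose first term is local and whose epimorphism is right almost split is
an almost split sequence. -/
lemma isAlmostSplitSeq_of_rightAlmostSplit [HasExt.{w} 𝒜] {S : ShortComplex 𝒜}
    (hS : S.ShortExact) (hZ : IsLocalObject S.X₁) (hg : RightAlmostSplit S.g) :
    IsAlmostSplitSeq hS := by
  have hf : ¬ IsSplitMono S.f := fun h => by
    obtain ⟨s, hs⟩ := hS.exists_section (r := retraction S.f) (by simp)
    exact hg.1 (isSplitEpi_of_comp_eq_id hs)
  refine (isAlmostSplitSeq_iff hS).2 ⟨hf, fun Z' a ha => ?_, hg.2⟩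
  obtain ⟨E, f', p, b, zero, hS', hb, hp⟩ := exists_pushout_shortExact hS a
  have : Mono f' := hS'.mono_f
  have := hS.mono_f
  by_cases hsplit : IsSplitEpi p
  · obtain ⟨r, hr⟩ := hS'.exists_retraction (s := section_ p) (by simp)
    dsimp only at r hr
    exact ⟨b ≫ r, by rw [reassoc_of% hb, hr, Category.comp_id]⟩
  · obtain ⟨t, ht⟩ := hg.2 _ p hsplit
    obtain ⟨ψ, hψ⟩ := hS.exact.lift' (f' ≫ t) (by rw [Category.assoc, ht, zero])
    exfalso
    rcases hZ.2 (a ≫ ψ) with hiso | hiso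
    · exact ha (isSplitMono_of_comp_eq_id (r := ψ ≫ inv (a ≫ ψ)) (by
        rw [← Category.assoc, IsIso.hom_inv_id]))
    · obtain ⟨σ, hσ⟩ := hS.exact.lift' (𝟙 _ - b ≫ t) (by simp [ht, hp])
      have h1 : S.f ≫ σ = 𝟙 _ - a ≫ ψ := by
        rw [← cancel_mono S.f, Category.assoc, hσ]
        simp [hψ, reassoc_of% hb]
      exact hf (isSplitMono_of_comp_eq_id (r := σ ≫ inv (𝟙 _ - a ≫ ψ)) (by
        rw [← Category.assoc, h1, IsIso.hom_inv_id]))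

/-- Indecomposable summands of the kernel of a right minimal, right determined epimorphism start
almost split sequences. -/
lemma existsAlmostSplitStartingAt_of_rightDetermined [HasExt.{w} 𝒜] (k : Type*) [Field k]
    [Linear k 𝒜] (homFin : ∀ A B : 𝒜, FiniteDimensional k (A ⟶ B)) (hKS : IsKrullSchmidtCat 𝒜)
    {K X Y C Z : 𝒜} {ι : K ⟶ X} {α : X ⟶ Y} {w : ι ≫ α = 0}
    (hS : (ShortComplex.mk ι α w).ShortExact) (hmin : RightMinimal α)
    (hα : RightDetermined C α) (hZK : IsDirectSummand Z K) (hZ : Indec Z) :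
    ExistsAlmostSplitStartingAt Z := by
  obtain ⟨i, r, hir⟩ := hZK
  have hZ' := hKS.isLocalObject_of_indec hZ
  have : Mono ι := hS.mono_f
  have : IsSplitMono i := isSplitMono_of_comp_eq_id hir
  have : Mono (i ≫ ι) := mono_comp _ _
  have hS' : (ShortComplex.mk (i ≫ ι) (cokernel.π (i ≫ ι)) (cokernel.condition _)).ShortExact :=
    { exact := ShortComplex.exact_cokernel _
      mono_f := ‹_›
      epi_g := inferInstanceAs (Epi (cokernel.π (i ≫ ι))) }
  have hq := rightDetermined_of_summand hS hα hir hS'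
  have hns : ¬ IsSplitEpi (cokernel.π (i ≫ ι)) := fun h => by
    obtain ⟨s, hs⟩ := hS'.exists_retraction (s := section_ (cokernel.π (i ≫ ι))) (by simp)
    exact hZ.1 (hmin.isZero_of_retract hs (by simp [w]))
  obtain ⟨W, x, hx, hx'⟩ := exists_minimal_not_factorsThru k homFin hKS hq hns
  obtain ⟨E, f, p, zero, hE, hfac⟩ := exists_pullback_shortExact hS' x
  refine ⟨W, E, f, p, zero, hE, isAlmostSplitSeq_of_rightAlmostSplit hE hZ' ⟨fun h => ?_, ?_⟩⟩
  · exact hx (by simpa using (hfac W (𝟙 W)).1 ⟨section_ p, by simp⟩)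
  · exact fun T c hc => (hfac T c).2 (hx' T c hc)

end Backward

/-- objects without injective summands lie in `𝒜_l` iff they occur as
kernels of right minimal, right determined epimorphisms. -/
theorem statement_17 {k : Type*} [Field k] [Linear k 𝒜] [HasExt.{w} 𝒜]
    (homFin : ∀ A B : 𝒜, FiniteDimensional k (A ⟶ B))
    (extFin : ∀ A B : 𝒜, FiniteDimensional k (Abelian.Ext A B 1))
    (hKS : IsKrullSchmidtCat 𝒜) {K : 𝒜}
    (hnoinj : ∀ Z : 𝒜, IsDirectSummand Z K → IsExtInjective Z → IsZero Z) :
    (∀ Z : 𝒜, IsDirectSummand Z K → Indec Z → ExistsAlmostSplitStartingAt Z) ↔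
      (∃ (X Y : 𝒜) (ι : K ⟶ X) (α : X ⟶ Y) (w : ι ≫ α = 0)
        (_ : (ShortComplex.mk ι α w).ShortExact),
        RightMinimal α ∧ ∃ C : 𝒜, RightDetermined C α) := by
  constructor
  · exact exists_rightMinimal_rightDetermined k homFin hKS
  · rintro ⟨X, Y, ι, α, w, hS, hmin, C, hC⟩ Z hZK hZ
    exact existsAlmostSplitStartingAt_of_rightDetermined k homFin hKS hS hmin hC hZK hZ
end

section
/- Let k be a field, 𝒜 a k-linear Hom-finite, Ext-finite and Krull–Schmidt abelian category, and C an indecomposable non-projective object. Then the following are equivalent: (1) there exists an almost split short exact sequence 0 → K → E → C → 0 ending at C; (2) for every object Y and every right End(C)-submodule H of Hom(C,Y) containing all projective morphisms C → Y, there exists a right C-determined epimorphism α: X → Y with H = {h ∈ Hom(C,Y) : h factors through α}; (3) there exists an epimorphism which is not a retraction and is right C-determined; (4) there exist an epimorphism α: X → Y and a morphism f: C → Y such that f almost factors through α. -/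
/- Preliminary definitions: the abelian-category instance of the extriangulated
notions of the paper (s-projective/injective morphisms and objects, almost split
short exact sequences, morphisms determined by objects, etc.). -/

open CategoryTheory CategoryTheory.Limits

attribute [local instance] CategoryTheory.Abelian.hasFiniteBiproducts

universe w v u

variable {𝒜 : Type u} [Category.{v} 𝒜] [Abelian 𝒜]

section Extensions

/-- The pushout of a short exact sequence along a morphism out of its first term. -/
lemma CategoryTheory.ShortComplex.ShortExact.shortExact_pushout {S : ShortComplex 𝒜}
    (hS : S.ShortExact) {A : 𝒜} (a : S.X₁ ⟶ A) :
    (ShortComplex.mk (pushout.inr S.f a)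
      (pushout.desc S.g (0 : A ⟶ S.X₃) (S.zero.trans comp_zero.symm))
      (pushout.inr_desc _ _ _)).ShortExact := by
  have := hS.mono_f
  have := hS.epi_g
  have w : S.f ≫ S.g = a ≫ 0 := S.zero.trans comp_zero.symm
  have hepi : Epi (pushout.desc S.g 0 w) := by
    have : Epi (pushout.inl S.f a ≫ pushout.desc S.g 0 w) := by
      rw [pushout.inl_desc]
      infer_instance
    exact epi_of_epi (pushout.inl S.f a) (pushout.desc S.g 0 w)
  refine ShortComplex.ShortExact.mk' (ShortComplex.exact_of_g_is_cokernel _ ?_)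
    (inferInstanceAs (Mono (pushout.inr S.f a))) hepi
  refine CokernelCofork.IsColimit.ofπ' _ _
    fun {Z} k (hk : pushout.inr S.f a ≫ k = 0) => ?_
  have hk' : S.f ≫ pushout.inl S.f a ≫ k = 0 := by
    rw [pushout.condition_assoc, hk, comp_zero]
  refine ⟨hS.exact.desc (pushout.inl S.f a ≫ k) hk', ?_⟩
  apply pushout.hom_ext
  · exact (pushout.inl_desc_assoc _ _ _ _).trans (hS.exact.g_desc _ _)
  · exact (pushout.inr_desc_assoc _ _ _ _).trans (zero_comp.trans hk.symm)

variable [HasExt.{w} 𝒜]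

open Abelian

/-- Every extension class is killed by the pullback along some epimorphism. -/
lemma exists_epi_mk₀_comp_eq_zero {Y A : 𝒜} (η : Ext Y A 1) :
    ∃ (X : 𝒜) (p : X ⟶ Y), Epi p ∧ (Ext.mk₀ p).comp η (zero_add 1) = 0 := by
  let := HasDerivedCategory.standard 𝒜
  let t : Triangulated.TStructure (DerivedCategory 𝒜) := DerivedCategory.TStructure.t
  obtain ⟨E, f, h, hT⟩ := Pretriangulated.distinguished_cocone_triangle₁ η.hom
  let A' := (DerivedCategory.singleFunctor 𝒜 0).obj A
  have hA₁ : t.IsLE (A'⟦(1 : ℤ)⟧) (-1) := t.isLE_shift A' 0 1 (-1)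
  have hA₂ : t.IsGE (A'⟦(1 : ℤ)⟧) (-1) := t.isGE_shift A' 0 1 (-1)
  have hT' := Pretriangulated.inv_rot_of_distTriang _ hT
  have : t.IsLE E 0 := t.isLE₂ _ hT' 0
    (t.isLE_shift (A'⟦(1 : ℤ)⟧) (-1) (-1) 0)
    (inferInstanceAs (((DerivedCategory.singleFunctor 𝒜 0).obj Y).IsLE 0))
  have : t.IsGE E 0 := t.isGE₂ _ hT' 0
    (t.isGE_shift (A'⟦(1 : ℤ)⟧) (-1) (-1) 0)
    (inferInstanceAs (((DerivedCategory.singleFunctor 𝒜 0).obj Y).IsGE 0))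
  obtain ⟨X, ⟨e⟩⟩ := E.exists_iso_singleFunctor_obj_of_isGE_of_isLE 0
  obtain ⟨p, hp⟩ := (DerivedCategory.singleFunctor 𝒜 0).map_surjective (e.inv ≫ f)
  refine ⟨X, p, Preadditive.epi_of_cancel_zero _ fun {Z} g hg => ?_, ?_⟩
  · apply (DerivedCategory.singleFunctor 𝒜 0).map_injective
    have hfg : f ≫ (DerivedCategory.singleFunctor 𝒜 0).map g = 0 := by
      rw [← cancel_epi e.inv, ← Category.assoc, ← hp, ← Functor.map_comp, hg]
      simp
    obtain ⟨q, hq⟩ := Pretriangulated.Triangle.yoneda_exact₂ _ hT _ hfg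
    have : q = 0 := t.zero_of_isLE_of_isGE q (-1) 0 (by lia) hA₁
      (inferInstanceAs (((DerivedCategory.singleFunctor 𝒜 0).obj Z).IsGE 0))
    rw [hq, this, Functor.map_zero]
    exact comp_zero
  · ext
    have h₀ : f ≫ η.hom = 0 := Pretriangulated.comp_distTriang_mor_zero₁₂ _ hT
    have h₁ : (DerivedCategory.singleFunctor 𝒜 0).map p ≫ η.hom = 0 := by
      rw [hp, Category.assoc, h₀, comp_zero]
    rw [← Ext.singleFunctor_map_comp_hom, h₁]
    simp

/-- Every element of `Ext¹` is the class of a short exact sequence. -/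
lemma exists_shortExact_extClass_eq {Y A : 𝒜} (η : Ext Y A 1) :
    ∃ (E : 𝒜) (i : A ⟶ E) (p : E ⟶ Y) (zero : i ≫ p = 0)
      (hS : (ShortComplex.mk i p zero).ShortExact), hS.extClass = η := by
  obtain ⟨X, p, hp, hpη⟩ := exists_epi_mk₀_comp_eq_zero η
  let S : ShortComplex 𝒜 := ShortComplex.mk (kernel.ι p) p (kernel.condition p)
  have hS : S.ShortExact := ShortComplex.ShortExact.mk'
    (ShortComplex.exact_of_f_is_kernel S (kernelIsKernel p))
    (inferInstanceAs (Mono (kernel.ι p))) hp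
  obtain ⟨x, hx⟩ := Ext.contravariant_sequence_exact₃ hS A η hpη (add_zero 1)
  obtain ⟨a, rfl⟩ := Ext.addEquiv₀.symm.surjective x
  refine ⟨_, _, _, _, hS.shortExact_pushout a, ?_⟩
  let φ : S ⟶ ShortComplex.mk (pushout.inr S.f a)
      (pushout.desc S.g (0 : A ⟶ S.X₃) (S.zero.trans comp_zero.symm))
      (pushout.inr_desc _ _ _) :=
    { τ₁ := a
      τ₂ := pushout.inl S.f a
      τ₃ := 𝟙 _
      comm₁₂ := pushout.condition.symm
      comm₂₃ := (pushout.inl_desc _ _ _).trans (Category.comp_id _).symm }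
  have h := ShortComplex.ShortExact.extClass_naturality hS (hS.shortExact_pushout a) φ
  rw [← hx]
  simpa [φ] using h.symm

end Extensions

lemma factorsThru_id_iff_isSplitEpi {𝒟 : Type*} [Category 𝒟] {X Y : 𝒟} (f : X ⟶ Y) :
    FactorsThru (𝟙 Y) f ↔ IsSplitEpi f :=
  ⟨fun ⟨t, ht⟩ => IsSplitEpi.mk' ⟨t, ht⟩, fun _ => ⟨section_ f, IsSplitEpi.id f⟩⟩

section Factorization

variable [HasExt.{w} 𝒜]

open Abelian

lemma CategoryTheory.ShortComplex.ShortExact.factorsThru_g_iff {S : ShortComplex 𝒜}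
    (hS : S.ShortExact) {T : 𝒜} (g : T ⟶ S.X₃) :
    FactorsThru g S.g ↔ (Ext.mk₀ g).comp hS.extClass (zero_add 1) = 0 := by
  constructor
  · rintro ⟨t, rfl⟩
    rw [← Ext.mk₀_comp_mk₀_assoc, hS.comp_extClass, Ext.comp_zero]
  · intro h
    obtain ⟨x, hx⟩ := Ext.covariant_sequence_exact₃ T hS (Ext.mk₀ g) (zero_add 1) h
    obtain ⟨t, rfl⟩ := Ext.addEquiv₀.symm.surjective x
    exact ⟨t, Ext.addEquiv₀.symm.injective (by simpa using hx)⟩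

lemma CategoryTheory.ShortComplex.ShortExact.isSplitEpi_g_iff {S : ShortComplex 𝒜}
    (hS : S.ShortExact) : IsSplitEpi S.g ↔ hS.extClass = 0 := by
  rw [← factorsThru_id_iff_isSplitEpi, hS.factorsThru_g_iff, Ext.mk₀_id_comp]

lemma CategoryTheory.ShortComplex.ShortExact.extClass_eq_zero_of_isSplitMono
    {S : ShortComplex 𝒜} (hS : S.ShortExact) [IsSplitMono S.f] : hS.extClass = 0 := by
  have h : (hS.extClass.comp (Ext.mk₀ S.f) (add_zero 1)).comp
      (Ext.mk₀ (retraction S.f)) (add_zero 1) = 0 := by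
    rw [hS.extClass_comp, Ext.zero_comp]
  rwa [Ext.comp_assoc_of_third_deg_zero, Ext.mk₀_comp_mk₀, IsSplitMono.id,
    Ext.comp_mk₀_id] at h

/-- An extension class killed by all pullbacks along non-retractions is a pushout of every
nonzero extension class with the same source. -/
lemma exists_comp_mk₀_eq {C K A : 𝒜} {η : Ext C K 1}
    (hη : ∀ (T : 𝒜) (c : T ⟶ C), ¬ IsSplitEpi c → (Ext.mk₀ c).comp η (zero_add 1) = 0)
    {δ : Ext C A 1} (hδ : δ ≠ 0) :
    ∃ a : A ⟶ K, δ.comp (Ext.mk₀ a) (add_zero 1) = η := by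
  obtain ⟨E, i, p, zero, hS, rfl⟩ := exists_shortExact_extClass_eq δ
  obtain ⟨x, hx⟩ := Ext.contravariant_sequence_exact₃ hS K η
    (hη _ _ (mt hS.isSplitEpi_g_iff.1 hδ)) (add_zero 1)
  obtain ⟨a, rfl⟩ := Ext.addEquiv₀.symm.surjective x
  exact ⟨a, hx⟩

/-- An extension class killed by all pushouts along non-sections is a pullback of every
nonzero extension class with the same target. -/
lemma exists_mk₀_comp_eq {C K T : 𝒜} {η : Ext C K 1}
    (hη : ∀ (X : 𝒜) (a : K ⟶ X), ¬ IsSplitMono a → η.comp (Ext.mk₀ a) (add_zero 1) = 0)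
    {ξ : Ext T K 1} (hξ : ξ ≠ 0) :
    ∃ h : C ⟶ T, (Ext.mk₀ h).comp ξ (zero_add 1) = η := by
  obtain ⟨E, i, p, zero, hS, rfl⟩ := exists_shortExact_extClass_eq ξ
  have hi : ¬ IsSplitMono i := fun hi => hξ
    (have : IsSplitMono (ShortComplex.mk i p zero).f := hi
     hS.extClass_eq_zero_of_isSplitMono)
  obtain ⟨x, hx⟩ := Ext.covariant_sequence_exact₁ C hS η (hη _ _ hi) (zero_add 1)
  obtain ⟨h, rfl⟩ := Ext.addEquiv₀.symm.surjective x
  exact ⟨h, hx⟩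

/-- Any finite family of extension classes is simultaneously trivialized by an epimorphism,
universally so. -/
lemma exists_epi_factorsThru_iff {ι : Type*} [Finite ι] {Y K : 𝒜} (ξ : ι → Ext Y K 1) :
    ∃ (X : 𝒜) (α : X ⟶ Y), Epi α ∧ ∀ (T : 𝒜) (g : T ⟶ Y),
      FactorsThru g α ↔ ∀ i, (Ext.mk₀ g).comp (ξ i) (zero_add 1) = 0 := by
  cases nonempty_fintype ι
  let e (T : 𝒜) : Ext T (⨁ fun _ : ι => K) 1 ≃+ (ι → Ext T K 1) :=
    Ext.addEquivBiproduct T (biproduct.isBilimit _) 1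
  have he (T : 𝒜) (g : T ⟶ Y) (δ : Ext Y (⨁ fun _ : ι => K) 1) (i : ι) :
      e T ((Ext.mk₀ g).comp δ (zero_add 1)) i = (Ext.mk₀ g).comp (e Y δ i) (zero_add 1) :=
    Ext.comp_assoc_of_third_deg_zero _ _ _ _
  obtain ⟨X, i, α, zero, hS, h⟩ := exists_shortExact_extClass_eq ((e Y).symm ξ)
  refine ⟨X, α, hS.epi_g, fun T g => (hS.factorsThru_g_iff g).trans ?_⟩
  rw [h, ← (e T).map_eq_zero_iff, funext_iff]
  simp only [he, AddEquiv.apply_symm_apply, Pi.zero_apply]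

end Factorization

section Radical

lemma isLocalRing_end_of_isIso {X Z : 𝒜} (e : X ≅ Z) [IsLocalRing (End Z)] :
    IsLocalRing (End X) := by
  have hnt : Nontrivial (End X) := by
    refine ⟨0, 1, fun h => zero_ne_one (α := End Z) ?_⟩
    have : e.inv ≫ (0 : X ⟶ X) ≫ e.hom = e.inv ≫ 𝟙 X ≫ e.hom := by
      rw [show (0 : X ⟶ X) = 𝟙 X from h]
    simpa using this
  refine IsLocalRing.of_isUnit_or_isUnit_one_sub_self fun (a : X ⟶ X) => ?_
  have key (b : X ⟶ X) (hb : IsUnit (End.of (e.inv ≫ b ≫ e.hom))) : IsUnit (End.of b) := by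
    have : IsIso (e.inv ≫ b ≫ e.hom) := (isUnit_iff_isIso _).1 hb
    have h : b = e.hom ≫ (e.inv ≫ b ≫ e.hom) ≫ e.inv := by simp
    rw [isUnit_iff_isIso, h]
    infer_instance
  refine (IsLocalRing.isUnit_or_isUnit_of_isUnit_add (R := End Z)
    (a := End.of (e.inv ≫ a ≫ e.hom)) (b := End.of (e.inv ≫ (𝟙 X - a) ≫ e.hom)) ?_).imp
    (key a) (key (𝟙 X - a))
  rw [isUnit_iff_isIso]
  have h : (e.inv ≫ a ≫ e.hom) + (e.inv ≫ (𝟙 X - a) ≫ e.hom) = 𝟙 Z := by simp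
  exact h ▸ inferInstanceAs (IsIso (𝟙 Z))

lemma Indec.isIso_of_isSplitEpi {X Z : 𝒜} (hX : Indec X) (hZ : ¬ IsZero Z) (r : X ⟶ Z)
    [IsSplitEpi r] : IsIso r := by
  have e := biprod.uniqueUpToIso _ _
    (isBilimitBinaryBiconeOfIsSplitEpiOfKernel (kernelIsKernel r))
  have hK : IsZero (kernel r) := (hX.2 _ _ ⟨e⟩).resolve_right hZ
  have : Mono r := Preadditive.mono_of_kernel_zero (hK.eq_zero_of_src _)
  exact isIso_of_mono_of_isSplitEpi r

lemma Indec.isLocalRing_end {C : 𝒜} (hC : Indec C) (hKS : IsKrullSchmidtCat 𝒜) :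
    IsLocalRing (End C) := by
  obtain ⟨n, Z, ⟨e⟩, hZ⟩ := hKS C
  have hn : Nonempty (Fin n) := by
    by_contra h
    rw [not_nonempty_iff] at h
    refine hC.1 ((IsZero.iff_id_eq_zero _).2 ?_)
    rw [← e.hom_inv_id, ← Category.id_comp e.inv, ← biproduct.total]
    simp
  obtain ⟨i⟩ := hn
  have := hZ i
  have hZi : ¬ IsZero (Z i) := fun h =>
    one_ne_zero (α := End (Z i)) (h.eq_zero_of_src _)
  have := hC.isIso_of_isSplitEpi hZi (e.hom ≫ biproduct.π Z i)
  exact isLocalRing_end_of_isIso (asIso (e.hom ≫ biproduct.π Z i))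

/-- In a Dedekind-finite local ring, an element without right inverse is in the radical. -/
lemma IsLocalRing.mem_jacobson_bot_of_forall_mul_ne_one {R : Type*} [Ring R] [IsLocalRing R]
    [IsDedekindFiniteMonoid R] {x : R} (hx : ∀ y, x * y ≠ 1) :
    x ∈ (⊥ : Ideal R).jacobson := by
  refine Ideal.mem_jacobson_iff.2 fun y => ?_
  have hy : ¬ IsUnit (y * x) := fun h => by
    obtain ⟨w, hw⟩ := h.exists_left_inv
    exact hx (w * y) (mul_eq_one_symm ((mul_assoc _ _ _).trans hw))
  have h1 : IsUnit (1 + y * x) :=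
    (IsLocalRing.isUnit_or_isUnit_of_isUnit_add (a := 1 + y * x) (b := -(y * x))
      (by simp)).resolve_right (by simpa using hy)
  obtain ⟨z, hz⟩ := h1.exists_left_inv
  refine ⟨z, (Ideal.mem_bot).2 ?_⟩
  rw [← hz]
  noncomm_ring

lemma Ideal.exists_one_sub_mul_mul_eq_one {R : Type*} [Ring R] [IsDedekindFiniteMonoid R]
    {x : R} (hx : x ∈ (⊥ : Ideal R).jacobson) (y : R) : ∃ z, (1 - x * y) * z = 1 := by
  obtain ⟨z, hz⟩ := Ideal.mem_jacobson_iff.1 hx (-y)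
  have h1 : z * (1 - y * x) = 1 := by
    rw [← sub_eq_zero, ← Ideal.mem_bot]
    convert hz using 1
    noncomm_ring
  have h2 : (1 - y * x) * z = 1 := mul_eq_one_symm h1
  refine ⟨1 + x * z * y, ?_⟩
  calc (1 - x * y) * (1 + x * z * y) = 1 + x * ((1 - y * x) * z - 1) * y := by noncomm_ring
    _ = 1 := by rw [h2]; simp

lemma inRadical_of_not_isSplitEpi {T C : 𝒜} [IsLocalRing (End C)]
    [IsDedekindFiniteMonoid (End C)] (c : T ⟶ C) (hc : ¬ IsSplitEpi c) : InRadical c :=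
  fun u => IsLocalRing.mem_jacobson_bot_of_forall_mul_ne_one (x := End.of (u ≫ c)) fun y hy =>
    hc (IsSplitEpi.mk' ⟨End.asHom y ≫ u, (Category.assoc _ _ _).trans hy⟩)

lemma exists_comp_id_sub_eq_id {C : 𝒜} [IsDedekindFiniteMonoid (End C)] {r : C ⟶ C}
    (hr : End.of r ∈ (⊥ : Ideal (End C)).jacobson) (g : C ⟶ C) :
    ∃ w : C ⟶ C, w ≫ (𝟙 C - g ≫ r) = 𝟙 C :=
  Ideal.exists_one_sub_mul_mul_eq_one hr (End.of g)

lemma isDedekindFiniteMonoid_end (k : Type*) [Field k] [Linear k 𝒜] (C : 𝒜)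
    [FiniteDimensional k (C ⟶ C)] : IsDedekindFiniteMonoid (End C) := by
  have : Module.Finite k (End C) := inferInstanceAs (Module.Finite k (C ⟶ C))
  have : IsArtinianRing (End C) := IsArtinianRing.of_finite k (End C)
  infer_instance

end Radical

section Determined

open Abelian

lemma RightDetermined.exists_almostFactorsThru (k : Type*) [Field k] [Linear k 𝒜] {C X Y : 𝒜}
    {α : X ⟶ Y} (hd : RightDetermined C α) (hα : ¬ IsSplitEpi α)
    [FiniteDimensional k (C ⟶ Y)] [IsDedekindFiniteMonoid (End C)] :
    ∃ f : C ⟶ Y, AlmostFactorsThru f α := by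
  have hne : {f : C ⟶ Y | ¬ FactorsThru f α}.Nonempty := by
    by_contra! h
    exact hα ((factorsThru_id_iff_isSplitEpi α).1
      (hd Y (𝟙 Y) fun f => not_not.1 (Set.eq_empty_iff_forall_notMem.1 h (f ≫ 𝟙 Y))))
  let S (f : C ⟶ Y) : Submodule k (C ⟶ Y) :=
    LinearMap.range (Linear.rightComp k C α) ⊔ LinearMap.range (Linear.rightComp k C f)
  obtain ⟨f, hf, hmin⟩ := WellFounded.has_min
    (measure fun f => Module.finrank k (S f)).wf _ hne
  refine ⟨f, hf, fun T h hh => hd T (h ≫ f) fun u => ?_⟩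
  rw [← Category.assoc]
  by_contra hr
  have hle : S ((u ≫ h) ≫ f) ≤ S f := by
    refine sup_le_sup_left ?_ _
    rintro _ ⟨g, rfl⟩
    exact ⟨g ≫ u ≫ h, by simp⟩
  have heq := Submodule.eq_of_le_of_finrank_le hle (not_lt.1 (hmin _ hr))
  have hfS : f ∈ S ((u ≫ h) ≫ f) := heq ▸ Submodule.mem_sup_right ⟨𝟙 C, by simp⟩
  obtain ⟨_, ⟨t, rfl⟩, _, ⟨g, rfl⟩, hfg⟩ := Submodule.mem_sup.1 hfS
  obtain ⟨w, hw⟩ := exists_comp_id_sub_eq_id (hh u) g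
  refine hf ⟨w ≫ t, ?_⟩
  have h1 : t ≫ α = (𝟙 C - g ≫ u ≫ h) ≫ f := by
    rw [Preadditive.sub_comp, eq_sub_iff_add_eq]
    simpa using hfg
  rw [Category.assoc, h1, ← Category.assoc, hw, Category.id_comp]

variable [HasExt.{w} 𝒜]

/-- If an extension class with indecomposable first term is killed by all pullbacks along
non-retractions, then it is killed by all pushouts along non-sections. -/
lemma comp_mk₀_eq_zero_of_not_isSplitMono {C K : 𝒜} [IsLocalRing (End K)] {η : Ext C K 1}
    (hη₀ : η ≠ 0)
    (hη : ∀ (T : 𝒜) (c : T ⟶ C), ¬ IsSplitEpi c → (Ext.mk₀ c).comp η (zero_add 1) = 0)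
    {X : 𝒜} (a : K ⟶ X) (ha : ¬ IsSplitMono a) : η.comp (Ext.mk₀ a) (add_zero 1) = 0 := by
  by_contra h
  obtain ⟨b, hb⟩ := exists_comp_mk₀_eq hη h
  rw [Ext.comp_assoc_of_third_deg_zero, Ext.mk₀_comp_mk₀] at hb
  rcases IsLocalRing.isUnit_or_isUnit_of_isUnit_add (a := End.of (a ≫ b))
    (b := 1 - End.of (a ≫ b)) (by rw [add_sub_cancel]; exact isUnit_one) with hu | hu
  · have : IsIso (a ≫ b) := (isUnit_iff_isIso _).1 hu
    exact ha (IsSplitMono.mk' ⟨b ≫ inv (a ≫ b), by rw [← Category.assoc, IsIso.hom_inv_id]⟩)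
  · have : IsIso (𝟙 K - a ≫ b) := (isUnit_iff_isIso _).1 hu
    have h1 : η.comp (Ext.mk₀ (𝟙 K - a ≫ b)) (add_zero 1) = 0 := by
      have h2 := congr_arg (fun f => η.comp (Ext.mk₀ f) (add_zero 1))
        (sub_add_cancel (𝟙 K) (a ≫ b))
      simp only [Ext.mk₀_add, Ext.comp_add, hb, Ext.comp_mk₀_id] at h2
      simpa using h2
    apply hη₀
    rw [← Ext.comp_mk₀_id η, ← IsIso.hom_inv_id (𝟙 K - a ≫ b), ← Ext.mk₀_comp_mk₀,
      ← Ext.comp_assoc_of_third_deg_zero, h1, Ext.zero_comp]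

lemma AlmostFactorsThru.existsAlmostSplitEndingAt (hKS : IsKrullSchmidtCat 𝒜) {C X Y : 𝒜}
    [IsLocalRing (End C)] [IsDedekindFiniteMonoid (End C)] {α : X ⟶ Y} [Epi α] {f : C ⟶ Y}
    (hf : AlmostFactorsThru f α) : ExistsAlmostSplitEndingAt C := by
  let S : ShortComplex 𝒜 := ShortComplex.mk (kernel.ι α) α (kernel.condition α)
  have hS : S.ShortExact := ShortComplex.ShortExact.mk'
    (ShortComplex.exact_of_f_is_kernel S (kernelIsKernel α))
    (inferInstanceAs (Mono (kernel.ι α))) (inferInstanceAs (Epi α))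
  let δ : Ext C (kernel α) 1 := (Ext.mk₀ f).comp hS.extClass (zero_add 1)
  have hδ₀ : δ ≠ 0 := fun h => hf.1 ((hS.factorsThru_g_iff f).2 h)
  have hδ (T : 𝒜) (c : T ⟶ C) (hc : ¬ IsSplitEpi c) :
      (Ext.mk₀ c).comp δ (zero_add 1) = 0 := by
    rw [Ext.mk₀_comp_mk₀_assoc]
    exact (hS.factorsThru_g_iff _).1 (hf.2 T c (inRadical_of_not_isSplitEpi c hc))
  obtain ⟨n, Z, ⟨e⟩, hZ⟩ := hKS (kernel α)
  obtain ⟨i, hi⟩ : ∃ i, δ.comp (Ext.mk₀ (e.hom ≫ biproduct.π Z i)) (add_zero 1) ≠ 0 := by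
    by_contra! h
    apply hδ₀
    have he : δ.comp (Ext.mk₀ e.hom) (add_zero 1) = 0 := by
      apply (Ext.addEquivBiproduct C (biproduct.isBilimit Z) 1).injective
      rw [map_zero]
      ext i
      rw [Pi.zero_apply, ← h i, ← Ext.mk₀_comp_mk₀, ← Ext.comp_assoc_of_third_deg_zero]
      rfl
    rw [← Ext.comp_mk₀_id δ, ← e.hom_inv_id, ← Ext.mk₀_comp_mk₀,
      ← Ext.comp_assoc_of_third_deg_zero, he, Ext.zero_comp]
  have := hZ i
  have hη (T : 𝒜) (c : T ⟶ C) (hc : ¬ IsSplitEpi c) : (Ext.mk₀ c).comp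
      (δ.comp (Ext.mk₀ (e.hom ≫ biproduct.π Z i)) (add_zero 1)) (zero_add 1) = 0 := by
    rw [← Ext.comp_assoc_of_third_deg_zero, hδ T c hc, Ext.zero_comp]
  obtain ⟨E, i', p, zero, hS', h⟩ := exists_shortExact_extClass_eq
    (δ.comp (Ext.mk₀ (e.hom ≫ biproduct.π Z i)) (add_zero 1))
  rw [← h] at hi hη
  exact ⟨Z i, E, i', p, zero, hS', hi,
    fun X' a ha => comp_mk₀_eq_zero_of_not_isSplitMono hi hη a ha, hη⟩

end Determined

section Linear

open Abelian

variable (k : Type*) [Field k] [Linear k 𝒜] [HasExt.{w} 𝒜]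

lemma extModule_smul_def {X Y : 𝒜} {n : ℕ} (r : k) (e : Ext X Y n) :
    r • e = (Ext.mk₀ (r • 𝟙 X)).comp e (zero_add n) := rfl

/-- The pullback of extension classes along morphisms, as a bilinear map. -/
noncomputable def extPullback (C Y K : 𝒜) : (C ⟶ Y) →ₗ[k] Ext Y K 1 →ₗ[k] Ext C K 1 :=
  LinearMap.mk₂ k (fun f ξ => (Ext.mk₀ f).comp ξ (zero_add 1))
    (fun f g ξ => by rw [Ext.mk₀_add, Ext.add_comp])
    (fun r f ξ => by
      rw [extModule_smul_def, Ext.mk₀_comp_mk₀_assoc, Linear.smul_comp, Category.id_comp])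
    (fun f ξ ξ' => by rw [Ext.comp_add])
    (fun r f ξ => by
      rw [extModule_smul_def, extModule_smul_def, Ext.mk₀_comp_mk₀_assoc,
        Ext.mk₀_comp_mk₀_assoc, Linear.smul_comp, Category.id_comp, Linear.comp_smul,
        Category.comp_id])

lemma extPullback_apply {C Y K : 𝒜} (f : C ⟶ Y) (ξ : Ext Y K 1) :
    extPullback k C Y K f ξ = (Ext.mk₀ f).comp ξ (zero_add 1) := rfl

variable {k}

/-- In the presence of a class behaving as that of an almost split sequence ending at `C`,
every morphism outside an `End C`-submodule `H` containing the projective morphisms is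
separated from `H` by an extension class. -/
lemma exists_mk₀_comp_ne_zero {C K Y : 𝒜} [FiniteDimensional k (Ext Y K 1)]
    {η : Ext C K 1} (hη₀ : η ≠ 0)
    (hl : ∀ (X : 𝒜) (a : K ⟶ X), ¬ IsSplitMono a → η.comp (Ext.mk₀ a) (add_zero 1) = 0)
    (hr : ∀ (T : 𝒜) (c : T ⟶ C), ¬ IsSplitEpi c → (Ext.mk₀ c).comp η (zero_add 1) = 0)
    {H : Submodule k (C ⟶ Y)} (hH : ∀ h ∈ H, ∀ g : C ⟶ C, g ≫ h ∈ H)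
    (hproj : ∀ f : C ⟶ Y, IsProjMorphism f → f ∈ H) {f : C ⟶ Y} (hf : f ∉ H) :
    ∃ ξ : Ext Y K 1, (∀ h ∈ H, (Ext.mk₀ h).comp ξ (zero_add 1) = 0) ∧
      (Ext.mk₀ f).comp ξ (zero_add 1) ≠ 0 := by
  obtain ⟨φ, hφ⟩ := Module.Projective.exists_dual_ne_zero k hη₀
  let B : (C ⟶ Y) →ₗ[k] Ext Y K 1 →ₗ[k] k := (extPullback k C Y K).compr₂ φ
  have hB (g : C ⟶ Y) (ξ : Ext Y K 1) : B g ξ = φ ((Ext.mk₀ g).comp ξ (zero_add 1)) := rfl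
  have hker : LinearMap.ker B ≤ H := by
    intro g hg
    refine hproj g fun A δ => ?_
    by_contra hδ
    obtain ⟨a, ha⟩ := exists_comp_mk₀_eq hr hδ
    rw [Ext.comp_assoc_of_third_deg_zero] at ha
    apply hφ
    rw [← ha, ← hB, LinearMap.mem_ker.1 hg, LinearMap.zero_apply]
  obtain ⟨ψ, hψf, hψ⟩ := Submodule.exists_dual_map_eq_bot_of_notMem hf inferInstance
  have hψH : ψ ∈ H.dualAnnihilator := (Submodule.mem_dualAnnihilator ψ).2 fun h hh => by
    simpa [hψ] using Submodule.mem_map_of_mem (f := ψ) hh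
  obtain ⟨ξ, rfl⟩ := (LinearMap.dualAnnihilator_ker_eq_range_flip (B := B)).le
    (Submodule.dualAnnihilator_anti hker hψH)
  refine ⟨ξ, fun h hh => ?_, fun h => hψf ?_⟩
  · by_contra hne
    obtain ⟨g, hg⟩ := exists_mk₀_comp_eq hl hne
    rw [Ext.mk₀_comp_mk₀_assoc] at hg
    apply hφ
    rw [← hg, ← hB]
    exact (Submodule.mem_dualAnnihilator _).1 hψH _ (hH h hh g)
  · rw [LinearMap.flip_apply, hB, h, map_zero]

lemma IsAlmostSplitSeq.exists_rightDetermined {S : ShortComplex 𝒜} {hS : S.ShortExact}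
    (h : IsAlmostSplitSeq hS) {Y : 𝒜} [FiniteDimensional k (Ext Y S.X₁ 1)]
    {H : Submodule k (S.X₃ ⟶ Y)} (hH : ∀ h ∈ H, ∀ g : S.X₃ ⟶ S.X₃, g ≫ h ∈ H)
    (hproj : ∀ f : S.X₃ ⟶ Y, IsProjMorphism f → f ∈ H) :
    ∃ (X : 𝒜) (α : X ⟶ Y), Epi α ∧ RightDetermined S.X₃ α ∧
      ∀ f : S.X₃ ⟶ Y, f ∈ H ↔ FactorsThru f α := by
  obtain ⟨h₀, hl, hr⟩ := h
  let W : Submodule k (Ext Y S.X₁ 1) := ⨅ f : H, LinearMap.ker (extPullback k S.X₃ Y S.X₁ f)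
  have hW (ξ : Ext Y S.X₁ 1) : ξ ∈ W ↔ ∀ f ∈ H, (Ext.mk₀ f).comp ξ (zero_add 1) = 0 := by
    simp [W, extPullback_apply]
  obtain ⟨s, hs⟩ := IsNoetherian.noetherian W
  obtain ⟨X, α, hα, hfac⟩ := exists_epi_factorsThru_iff (fun i : s => (i : Ext Y S.X₁ 1))
  have hfac' (T : 𝒜) (g : T ⟶ Y) : FactorsThru g α ↔
      ∀ ξ ∈ W, (Ext.mk₀ g).comp ξ (zero_add 1) = 0 := by
    rw [hfac, ← hs]
    change _ ↔ Submodule.span k (s : Set _) ≤ LinearMap.ker (extPullback k T Y S.X₁ g)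
    rw [Submodule.span_le, Subtype.forall]
    rfl
  refine ⟨X, α, hα, fun T g hg => (hfac' T g).2 fun ξ hξ => ?_, fun f => ?_⟩
  · by_contra hne
    obtain ⟨u, hu⟩ := exists_mk₀_comp_eq hl hne
    rw [Ext.mk₀_comp_mk₀_assoc, (hfac' _ _).1 (hg u) ξ hξ] at hu
    exact h₀ hu.symm
  · refine ⟨fun hf => (hfac' _ f).2 fun ξ hξ => (hW ξ).1 hξ f hf, fun hf => ?_⟩
    by_contra hfH
    obtain ⟨ξ, hξ, hne⟩ := exists_mk₀_comp_ne_zero h₀ hl hr hH hproj hfH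
    exact hne ((hfac' _ f).1 hf ξ ((hW ξ).2 hξ))

end Linear

section Projective

open Abelian

variable [HasExt.{w} 𝒜]

/-- The additive subgroup of projective morphisms. -/
def projMorphisms (X Y : 𝒜) : AddSubgroup (X ⟶ Y) where
  carrier := {f | IsProjMorphism f}
  zero_mem' A δ := by rw [Ext.mk₀_zero, Ext.zero_comp]
  add_mem' hf hg A δ := by rw [Ext.mk₀_add, Ext.add_comp, hf, hg, add_zero]
  neg_mem' {f} hf A δ := by rw [Ext.mk₀_neg, Ext.neg_comp, hf, neg_zero]

lemma isProjMorphism_id_iff {X : 𝒜} : IsProjMorphism (𝟙 X) ↔ IsExtProjective X := by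
  simp [IsProjMorphism, IsExtProjective]

end Projective

/-- the main characterization of indecomposable non-projective
objects of `𝒜_r` via morphisms determined by objects. -/
theorem statement_18 {k : Type*} [Field k] [Linear k 𝒜] [HasExt.{w} 𝒜]
    (homFin : ∀ A B : 𝒜, FiniteDimensional k (A ⟶ B))
    (extFin : ∀ A B : 𝒜, FiniteDimensional k (Abelian.Ext A B 1))
    (hKS : IsKrullSchmidtCat 𝒜)
    {C : 𝒜} (hC : Indec C) (hCnp : ¬ IsExtProjective C) :
    List.TFAE [
      ExistsAlmostSplitEndingAt C,
      ∀ (Y : 𝒜) (H : AddSubgroup (C ⟶ Y)),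
        (∀ h ∈ H, ∀ g : C ⟶ C, g ≫ h ∈ H) →
        (∀ f : C ⟶ Y, IsProjMorphism f → f ∈ H) →
        ∃ (X : 𝒜) (α : X ⟶ Y), Epi α ∧ RightDetermined C α ∧
          ∀ h : C ⟶ Y, h ∈ H ↔ FactorsThru h α,
      ∃ (X Y : 𝒜) (α : X ⟶ Y), Epi α ∧ ¬ IsSplitEpi α ∧ RightDetermined C α,
      ∃ (X Y : 𝒜) (α : X ⟶ Y) (f : C ⟶ Y), Epi α ∧ AlmostFactorsThru f α] := by
  have := homFin C
  have := hC.isLocalRing_end hKS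
  have := isDedekindFiniteMonoid_end k C
  tfae_have 1 → 2 := by
    rintro ⟨K, E, i, p, zero, hS, h⟩ Y H hH hproj
    have := extFin Y K
    let H' : Submodule k (C ⟶ Y) :=
      { H with
        smul_mem' r f hf := by simpa using hH f hf (r • 𝟙 C) }
    exact h.exists_rightDetermined (H := H') hH hproj
  tfae_have 2 → 3 := by
    intro h
    obtain ⟨X, α, hα, hd, hH⟩ := h C (projMorphisms C C)
      (fun f hf g A δ => by rw [← Abelian.Ext.mk₀_comp_mk₀_assoc, hf, Abelian.Ext.comp_zero])
      (fun f hf => hf)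
    exact ⟨X, C, α, hα, fun hs => hCnp (isProjMorphism_id_iff.1
      ((hH _).2 ((factorsThru_id_iff_isSplitEpi α).2 hs))), hd⟩
  tfae_have 3 → 4 := by
    rintro ⟨X, Y, α, hα, hs, hd⟩
    have := homFin C Y
    obtain ⟨f, hf⟩ := hd.exists_almostFactorsThru k hs
    exact ⟨X, Y, α, f, hα, hf⟩
  tfae_have 4 → 1 := by
    rintro ⟨X, Y, α, f, hα, hf⟩
    exact hf.existsAlmostSplitEndingAt hKS
  tfae_finish
end
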